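/- Let C̲ be a G-coalgebra. The following assertions are equivalent: (1) C̲ is strong; (2) the adjoint pair (F,G) between M^{G,C̲} and M^{C_e} (where F(M̲) = M_e and G(N)_α = N □_{C_e} C_α) is a pair of inverse equivalences; equivalently, for every right G-C̲-comodule M̲ and every α ∈ G, the corestriction of ρ_{e,α} : M_α → M_e ⊗ C_α to M_e □_{C_e} C_α is bijective; (3) for all α,β ∈ G, Δ_{α,β} corestricts to an isomorphism C_{αβ} → C_α □_{C_e} C_β, i.e. Δ_{α,β} is injective with image exactly C_α □_{C_e} C_β ⊆ C_α ⊗ C_β. -/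

import Mathlib

open TensorProduct

universe u

/-- A `G`-group coalgebra over `k`: a family of `k`-vector spaces `C α` with
comultiplications `Δ_{α,β} : C (α*β) → C α ⊗ C β` and a counit `ε : C 1 → k`.
The comultiplication takes an explicit proof `γ = α * β` to avoid dependent casts. -/
structure GCoalgebra (k : Type u) [Field k] (G : Type u) [Group G] where
  C : G → Type u
  [acg : ∀ α, AddCommGroup (C α)]
  [mod : ∀ α, Module k (C α)]
  Δ : ∀ ⦃γ⦄ (α β : G), γ = α * β → (C γ →ₗ[k] C α ⊗[k] C β)
  ε : C 1 →ₗ[k] k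
  coassoc : ∀ ⦃δ δ₁ δ₂ : G⦄ (α β γ : G) (h₁ : δ = δ₁ * γ) (h₁' : δ₁ = α * β)
      (h₂ : δ = α * δ₂) (h₂' : δ₂ = β * γ),
      (TensorProduct.assoc k (C α) (C β) (C γ)).toLinearMap ∘ₗ
        (TensorProduct.map (Δ α β h₁') LinearMap.id) ∘ₗ Δ δ₁ γ h₁
      = (TensorProduct.map LinearMap.id (Δ β γ h₂')) ∘ₗ Δ α δ₂ h₂
  counit_right : ∀ (α : G) (h : α = α * 1),
      (TensorProduct.rid k (C α)).toLinearMap ∘ₗ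
        (TensorProduct.map LinearMap.id ε) ∘ₗ Δ α 1 h = LinearMap.id
  counit_left : ∀ (α : G) (h : α = 1 * α),
      (TensorProduct.lid k (C α)).toLinearMap ∘ₗ
        (TensorProduct.map ε LinearMap.id) ∘ₗ Δ 1 α h = LinearMap.id

attribute [instance] GCoalgebra.acg GCoalgebra.mod

variable {k : Type u} [Field k] {G : Type u} [Group G]

/-- A right `G`-`C̲`-comodule. -/
structure GComodule (Cc : GCoalgebra k G) where
  M : G → Type u
  [acg : ∀ α, AddCommGroup (M α)]
  [mod : ∀ α, Module k (M α)]
  ρ : ∀ ⦃γ⦄ (α β : G), γ = α * β → (M γ →ₗ[k] M α ⊗[k] Cc.C β)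
  counit : ∀ (α : G) (h : α = α * 1),
      (TensorProduct.rid k (M α)).toLinearMap ∘ₗ
        (TensorProduct.map LinearMap.id Cc.ε) ∘ₗ ρ α 1 h = LinearMap.id
  coassoc : ∀ ⦃δ δ₁ δ₂ : G⦄ (α β γ : G) (h₁ : δ = δ₁ * γ) (h₁' : δ₁ = α * β)
      (h₂ : δ = α * δ₂) (h₂' : δ₂ = β * γ),
      (TensorProduct.assoc k (M α) (Cc.C β) (Cc.C γ)).toLinearMap ∘ₗ
        (TensorProduct.map (ρ α β h₁') LinearMap.id) ∘ₗ ρ δ₁ γ h₁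
      = (TensorProduct.map LinearMap.id (Cc.Δ β γ h₂')) ∘ₗ ρ α δ₂ h₂

attribute [instance] GComodule.acg GComodule.mod

/-- A morphism of right `G`-`C̲`-comodules. -/
structure GComodHom {Cc : GCoalgebra k G} (M N : GComodule Cc) where
  φ : ∀ α, M.M α →ₗ[k] N.M α
  colinear : ∀ ⦃γ⦄ (α β : G) (h : γ = α * β),
      (TensorProduct.map (φ α) LinearMap.id) ∘ₗ M.ρ α β h = N.ρ α β h ∘ₗ φ γ

/-- A `G`-coalgebra is strong if all comultiplication maps are injective. -/
def GCoalgebra.Strong (Cc : GCoalgebra k G) : Prop :=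
  ∀ (α β : G), Function.Injective (Cc.Δ α β rfl)
/-- The cotensor product `N □_{C_e} P` of a right `C_e`-comodule `(N, ρN)` and a left
`C_e`-comodule `(P, lamP)`: the kernel of `ρN ⊗ id - id ⊗ lamP : N ⊗ P → (N ⊗ C_e) ⊗ P`. -/
noncomputable def cotensor {k G : Type u} [Field k] [Group G] {Cc : GCoalgebra k G}
    {N P : Type u} [AddCommGroup N] [Module k N] [AddCommGroup P] [Module k P]
    (ρN : N →ₗ[k] N ⊗[k] Cc.C 1) (lamP : P →ₗ[k] Cc.C 1 ⊗[k] P) :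
    Submodule k (N ⊗[k] P) :=
  LinearMap.ker
    (TensorProduct.map ρN LinearMap.id -
      (TensorProduct.assoc k N (Cc.C 1) P).symm.toLinearMap ∘ₗ
        TensorProduct.map LinearMap.id lamP)
section TensorNaturality

variable {R M N P A B D E : Type*} [CommRing R]
  [AddCommGroup M] [Module R M] [AddCommGroup N] [Module R N] [AddCommGroup P] [Module R P]
  [AddCommGroup A] [Module R A] [AddCommGroup B] [Module R B] [AddCommGroup D] [Module R D]
  [AddCommGroup E] [Module R E]

/-- Contracting the last leg of `id ⊗ d` with `e`, after applying `q` to the first two legs. -/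
theorem rid_map_map_assoc_symm (q : M ⊗[R] N →ₗ[R] P) (d : D →ₗ[R] N ⊗[R] A) (e : A →ₗ[R] R)
    (x : M ⊗[R] D) :
    TensorProduct.rid R P (TensorProduct.map LinearMap.id e (TensorProduct.map q LinearMap.id
        ((TensorProduct.assoc R M N A).symm (TensorProduct.map LinearMap.id d x))))
      = q (TensorProduct.map LinearMap.id
          ((TensorProduct.rid R N).toLinearMap ∘ₗ TensorProduct.map LinearMap.id e ∘ₗ d) x) := by
  induction x with
  | zero => simp
  | add x y hx hy => simp only [map_add, hx, hy]
  | tmul m c =>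
    simp only [TensorProduct.map_tmul, LinearMap.id_apply, LinearMap.comp_apply,
      LinearEquiv.coe_coe]
    induction d c with
    | zero => simp
    | add x y hx hy => simp only [map_add, TensorProduct.tmul_add, hx, hy]
    | tmul n a => simp

/-- Splitting the last leg of `id ⊗ d`, after applying `q` to the first two legs. -/
theorem map_map_assoc_symm_of_coassoc {L : Type*} [AddCommGroup L] [Module R L]
    (q : M ⊗[R] N →ₗ[R] P) (d : D →ₗ[R] N ⊗[R] A) (s : A →ₗ[R] B ⊗[R] E)
    (d' : D →ₗ[R] L ⊗[R] E) (t : L →ₗ[R] N ⊗[R] B)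
    (h : (TensorProduct.assoc R N B E).toLinearMap ∘ₗ TensorProduct.map t LinearMap.id ∘ₗ d'
      = TensorProduct.map LinearMap.id s ∘ₗ d) (x : M ⊗[R] D) :
    TensorProduct.map LinearMap.id s (TensorProduct.map q LinearMap.id
        ((TensorProduct.assoc R M N A).symm (TensorProduct.map LinearMap.id d x)))
      = TensorProduct.assoc R P B E (TensorProduct.map
          (TensorProduct.map q LinearMap.id ∘ₗ (TensorProduct.assoc R M N B).symm.toLinearMap ∘ₗ
            TensorProduct.map LinearMap.id t) LinearMap.id
          ((TensorProduct.assoc R M L E).symm (TensorProduct.map LinearMap.id d' x))) := by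
  induction x with
  | zero => simp
  | add x y hx hy => simp only [map_add, hx, hy]
  | tmul m c =>
    have hc := LinearMap.congr_fun h c
    simp only [LinearMap.comp_apply, LinearEquiv.coe_coe] at hc
    have h₁ : ∀ z : N ⊗[R] A, TensorProduct.map LinearMap.id s (TensorProduct.map q LinearMap.id
        ((TensorProduct.assoc R M N A).symm (m ⊗ₜ[R] z)))
        = TensorProduct.map q LinearMap.id ((TensorProduct.assoc R M N (B ⊗[R] E)).symm
          (m ⊗ₜ[R] TensorProduct.map LinearMap.id s z)) := by
      intro z
      induction z with
      | zero => simp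
      | add x y hx hy => simp only [map_add, TensorProduct.tmul_add, hx, hy]
      | tmul n a => simp
    have h₂ : ∀ (z : N ⊗[R] B) (y : E), TensorProduct.map q LinearMap.id
        ((TensorProduct.assoc R M N (B ⊗[R] E)).symm
          (m ⊗ₜ[R] TensorProduct.assoc R N B E (z ⊗ₜ[R] y)))
        = TensorProduct.assoc R P B E (TensorProduct.map q LinearMap.id
          ((TensorProduct.assoc R M N B).symm (m ⊗ₜ[R] z)) ⊗ₜ[R] y) := by
      intro z y
      induction z with
      | zero => simp
      | add x y hx hy => simp only [map_add, TensorProduct.tmul_add, TensorProduct.add_tmul, hx, hy]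
      | tmul n a => simp
    simp only [TensorProduct.map_tmul, LinearMap.id_apply]
    rw [h₁, ← hc]
    induction d' c with
    | zero => simp
    | add x y hx hy => simp only [map_add, TensorProduct.tmul_add, hx, hy]
    | tmul l y => simpa using h₂ (t l) y

end TensorNaturality

theorem mem_cotensor_iff {Cc : GCoalgebra k G}
    {N P : Type u} [AddCommGroup N] [Module k N] [AddCommGroup P] [Module k P]
    {ρN : N →ₗ[k] N ⊗[k] Cc.C 1} {lamP : P →ₗ[k] Cc.C 1 ⊗[k] P} {x : N ⊗[k] P} :
    x ∈ cotensor ρN lamP ↔ TensorProduct.map ρN LinearMap.id x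
      = (TensorProduct.assoc k N (Cc.C 1) P).symm (TensorProduct.map LinearMap.id lamP x) := by
  simp [cotensor, sub_eq_zero]

theorem GCoalgebra.Strong.injective {Cc : GCoalgebra k G} (hC : Cc.Strong) ⦃γ : G⦄ (α β : G)
    (h : γ = α * β) : Function.Injective (Cc.Δ α β h) := by
  subst h
  exact hC α β

namespace GComodule

variable {Cc : GCoalgebra k G}

theorem range_le_cotensor (M : GComodule Cc) ⦃γ : G⦄ (α β : G) (h : γ = α * β) :
    LinearMap.range (M.ρ α β h)
      ≤ cotensor (M.ρ α 1 (mul_one α).symm) (Cc.Δ 1 β (one_mul β).symm) := by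
  rintro _ ⟨y, rfl⟩
  rw [mem_cotensor_iff, LinearEquiv.eq_symm_apply]
  exact LinearMap.congr_fun
    (M.coassoc α 1 β h (mul_one α).symm h (one_mul β).symm) y

theorem injective_of_strong (hC : Cc.Strong) (M : GComodule Cc) ⦃γ : G⦄ (α β : G)
    (h : γ = α * β) : Function.Injective (M.ρ α β h) := by
  have hγ : Function.Injective (M.ρ γ 1 (mul_one γ).symm) := fun x y hxy => by
    have hc := M.counit γ (mul_one γ).symm
    have hx := LinearMap.congr_fun hc x
    have hy := LinearMap.congr_fun hc y
    simp only [LinearMap.comp_apply, LinearMap.id_apply] at hx hy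
    rw [← hx, ← hy, hxy]
  have hΔ : Function.Injective (TensorProduct.map (LinearMap.id : M.M γ →ₗ[k] M.M γ)
      (Cc.Δ β⁻¹ β (inv_mul_cancel β).symm)) :=
    Module.Flat.lTensor_preserves_injective_linearMap _ (hC.injective _ _ _)
  have hco := M.coassoc γ β⁻¹ β h (by rw [h, mul_inv_cancel_right]) (mul_one γ).symm
    (inv_mul_cancel β).symm
  have hinj := hΔ.comp hγ
  rw [← LinearMap.coe_comp, ← hco, ← LinearMap.comp_assoc, LinearMap.coe_comp] at hinj
  exact hinj.of_comp

theorem range_eq_cotensor_of_strong (hC : Cc.Strong) (M : GComodule Cc) ⦃γ : G⦄ (α β : G)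
    (h : γ = α * β) :
    LinearMap.range (M.ρ α β h)
      = cotensor (M.ρ α 1 (mul_one α).symm) (Cc.Δ 1 β (one_mul β).symm) := by
  refine le_antisymm (M.range_le_cotensor α β h) fun x hx => ?_
  rw [mem_cotensor_iff] at hx
  set q := (LinearMap.range (M.ρ α β h)).mkQ
  have hqρ : q ∘ₗ M.ρ α β h = 0 := LinearMap.range_mkQ_comp _
  have hα : α = γ * β⁻¹ := by rw [h, mul_inv_cancel_right]
  have hzero : TensorProduct.map q LinearMap.id ∘ₗ
      (TensorProduct.assoc k (M.M α) (Cc.C β) (Cc.C β⁻¹)).symm.toLinearMap ∘ₗ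
        TensorProduct.map LinearMap.id (Cc.Δ β β⁻¹ (mul_inv_cancel β).symm) ∘ₗ
          M.ρ α 1 (mul_one α).symm = 0 := by
    rw [← M.coassoc α β β⁻¹ hα h]
    ext y
    simp only [LinearMap.comp_apply, LinearEquiv.coe_coe, LinearEquiv.symm_apply_apply,
      LinearMap.zero_apply]
    rw [← LinearMap.comp_apply, ← TensorProduct.map_comp, hqρ]
    simp
  have hΔ : Function.Injective (TensorProduct.map
      (LinearMap.id : (_ ⧸ LinearMap.range (M.ρ α β h)) →ₗ[k] _)
      (Cc.Δ β⁻¹ β (inv_mul_cancel β).symm)) :=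
    Module.Flat.lTensor_preserves_injective_linearMap _ (hC.injective _ _ _)
  have hsplit := map_map_assoc_symm_of_coassoc q _ _ _ _
    (Cc.coassoc β β⁻¹ β (one_mul β).symm (mul_inv_cancel β).symm (mul_one β).symm
      (inv_mul_cancel β).symm) x
  rw [← hx, ← LinearMap.comp_apply (TensorProduct.map _ _) (TensorProduct.map (M.ρ α 1 _) _),
    ← TensorProduct.map_comp, LinearMap.comp_assoc, LinearMap.comp_assoc, hzero,
    TensorProduct.map_zero_left, LinearMap.zero_apply, map_zero] at hsplit
  have hcontract := rid_map_map_assoc_symm q (Cc.Δ β 1 (mul_one β).symm) Cc.ε x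
  rw [(map_eq_zero_iff _ hΔ).1 hsplit, map_zero, map_zero, Cc.counit_right,
    TensorProduct.map_id, LinearMap.id_apply] at hcontract
  exact (Submodule.Quotient.mk_eq_zero _).1 hcontract.symm

/-- The left translate by `σ` of the regular comodule: its component at `α` is `C (σ * α)`. -/
def translate (Cc : GCoalgebra k G) (σ : G) : GComodule Cc where
  M α := Cc.C (σ * α)
  ρ _ α β h := Cc.Δ (σ * α) β (by rw [h, mul_assoc])
  counit α _ := Cc.counit_right (σ * α) _
  coassoc _ _ _ α β γ _ _ _ h := Cc.coassoc (σ * α) β γ _ _ _ h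

/-- A `G`-coalgebra, seen as a right comodule over itself. -/
def regular (Cc : GCoalgebra k G) : GComodule Cc where
  M := Cc.C
  ρ := Cc.Δ
  counit := Cc.counit_right
  coassoc := Cc.coassoc

end GComodule

theorem GCoalgebra.strong_of_injective {Cc : GCoalgebra k G}
    (hinj : ∀ (M : GComodule Cc) (α : G), Function.Injective (M.ρ 1 α (one_mul α).symm)) :
    Cc.Strong := by
  intro σ α
  have key : ∀ τ (_ : τ = σ) (h : σ * α = τ * α), Function.Injective (Cc.Δ τ α h) →
      Function.Injective (Cc.Δ σ α rfl) := by
    rintro _ rfl _ h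
    exact h
  exact key (σ * 1) (mul_one σ) _ (hinj (GComodule.translate Cc σ) α)

/-- **Theorem 1.7.** For a `G`-coalgebra `C̲` the following are equivalent:
(1) `C̲` is strong;
(2) the adjoint pair `(F,G)` between `M^{G,C̲}` and `M^{C_e}` is a pair of inverse
equivalences, i.e. for every right `G`-`C̲`-comodule `M̲` and every `α`, the
corestriction of `ρ_{e,α} : M_α → M_e ⊗ C_α` to `M_e □_{C_e} C_α` is bijective;
(3) every `Δ_{α,β}` corestricts to an isomorphism `C_{αβ} → C_α □_{C_e} C_β`, i.e.
`Δ_{α,β}` is injective with image exactly `C_α □_{C_e} C_β`. -/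
theorem strong_tfae_equivalence {k G : Type u} [Field k] [Group G]
    (Cc : GCoalgebra k G) :
    List.TFAE
      [ Cc.Strong,
        ∀ (M : GComodule Cc) (α : G),
          Function.Injective (M.ρ 1 α (one_mul α).symm) ∧
          LinearMap.range (M.ρ 1 α (one_mul α).symm)
            = cotensor (M.ρ 1 1 (one_mul 1).symm) (Cc.Δ 1 α (one_mul α).symm),
        ∀ ⦃γ : G⦄ (α β : G) (h : γ = α * β),
          Function.Injective (Cc.Δ α β h) ∧
          LinearMap.range (Cc.Δ α β h)
            = cotensor (Cc.Δ α 1 (mul_one α).symm) (Cc.Δ 1 β (one_mul β).symm) ] := by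
  tfae_have 1 → 2 := fun hC M α =>
    ⟨M.injective_of_strong hC 1 α _, M.range_eq_cotensor_of_strong hC 1 α _⟩
  tfae_have 2 → 1 := fun h => GCoalgebra.strong_of_injective fun M α => (h M α).1
  tfae_have 1 → 3 := fun hC _ α β h =>
    ⟨hC.injective α β h, (GComodule.regular Cc).range_eq_cotensor_of_strong hC α β h⟩
  tfae_have 3 → 1 := fun h α β => (h α β rfl).1
  tfae_finish
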